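/- In any core allocation x of a housing market with n agents, for every integer r with 1 ≤ r ≤ n, the number of agents i with rk_i(x_i) ≥ r is at most n − r + 1. -/

import Mathlib

open Finset

/-! ## Shapley–Scarf housing markets

There are `n` agents; agent `i` owns house `i` (houses are identified with their
owners).  Agent `i`'s strict linear preference over the `n` houses is encoded by
the bijection `pref i` sending each house to its position in `i`'s preference
list (position `0` = most preferred). -/

/-- Agent `i` strictly prefers house `h` to house `h'`. -/
def Prefers {n : ℕ} (pref : Fin n → (Fin n ≃ Fin n)) (i h h' : Fin n) : Prop :=
  pref i h < pref i h'

instance {n : ℕ} (pref : Fin n → (Fin n ≃ Fin n)) (i h h' : Fin n) :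
    Decidable (Prefers pref i h h') :=
  inferInstanceAs (Decidable (pref i h < pref i h'))

/-- The rank of house `h` for agent `i`: the number of houses weakly preferred
by `i` to `h` (the most preferred house has rank 1). -/
def rk {n : ℕ} (pref : Fin n → (Fin n ≃ Fin n)) (i h : Fin n) : ℕ :=
  (Finset.univ.filter fun h' => pref i h' ≤ pref i h).card

/-- `x` is an allocation of the submarket consisting of the agents in `S` (and
their houses): it redistributes the houses of `S` among the members of `S`,
each agent receiving exactly one house. -/
def IsAllocOn {n : ℕ} (S : Finset (Fin n)) (x : Fin n → Fin n) : Prop :=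
  Set.BijOn x ↑S ↑S

/-- `x` is a core allocation of the submarket consisting of the agents in `S`:
it is an allocation on `S` and no nonempty coalition `T ⊆ S` can redistribute
its own endowment `{ω_i : i ∈ T} = T` among itself so that every member of `T`
is strictly better off than under `x`. -/
def IsCoreOn {n : ℕ} (pref : Fin n → (Fin n ≃ Fin n)) (S : Finset (Fin n))
    (x : Fin n → Fin n) : Prop :=
  IsAllocOn S x ∧
    ¬ ∃ (T : Finset (Fin n)) (y : Fin n → Fin n), T ⊆ S ∧ T.Nonempty ∧
        Set.BijOn y ↑T ↑T ∧ ∀ i ∈ T, Prefers pref i (y i) (x i)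

/-- `x` is a core allocation of the whole housing market. -/
def IsCore {n : ℕ} (pref : Fin n → (Fin n ≃ Fin n)) (x : Fin n → Fin n) : Prop :=
  IsCoreOn pref Finset.univ x

/-- An extended housing market: `com` assigns each agent to one of `k`
communities; `community com j` is the set of agents of community `j`. -/
def community {n k : ℕ} (com : Fin n → Fin k) (j : Fin k) : Finset (Fin n) :=
  Finset.univ.filter fun i => com i = j

/-- The `n`-th harmonic number, as a rational number. -/
def H (n : ℕ) : ℚ := ∑ i ∈ Finset.range n, (1 : ℚ) / (i + 1)

/-- A self-map of a nonempty finite set permutes some nonempty subset. -/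
theorem exists_bijOn_subset {α : Type*} [DecidableEq α] (f : α → α) (A : Finset α)
    (hA : A.Nonempty) (hf : Set.MapsTo f A A) :
    ∃ T ⊆ A, T.Nonempty ∧ Set.BijOn f ↑T ↑T := by
  induction A using Finset.strongInduction with
  | H A ih =>
    have hsub : A.image f ⊆ A := Finset.image_subset_iff.2 fun a ha => hf ha
    by_cases h : A.image f = A
    · refine ⟨A, subset_rfl, hA, hf, Finset.card_image_iff.1 (by rw [h]), ?_⟩
      rw [Set.SurjOn, ← Finset.coe_image, h]
    · obtain ⟨T, hT, hne, hbij⟩ := ih _ (hsub.ssubset_of_ne h) (hA.image f)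
        fun a ha => Finset.mem_image_of_mem f (hsub ha)
      exact ⟨T, hT.trans hsub, hne, hbij⟩

/-- In a core allocation, every nonempty coalition has a member who strictly prefers no house
of the coalition to the house received. -/
theorem IsCore.exists_forall_not_prefers {n : ℕ} {pref : Fin n → (Fin n ≃ Fin n)}
    {x : Fin n → Fin n} (hx : IsCore pref x) {A : Finset (Fin n)} (hA : A.Nonempty) :
    ∃ a ∈ A, ∀ h ∈ A, ¬ Prefers pref a h (x a) := by
  by_contra! hcon
  choose! f hfA hf using hcon
  obtain ⟨T, hTA, hne, hbij⟩ := exists_bijOn_subset f A hA hfA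
  exact hx.2 ⟨T, f, Finset.subset_univ T, hne, hbij, fun i hi => hf i (hTA hi)⟩

/-- In any core allocation `x` of a housing market with `n`
agents, for every `1 ≤ r ≤ n`, the number of agents `i` with `rk_i(x_i) ≥ r`
is at most `n - r + 1`. -/
theorem core_rank_ge_count_bound (n : ℕ) (pref : Fin n → (Fin n ≃ Fin n))
    (x : Fin n → Fin n) (hx : IsCore pref x) (r : ℕ) (hr1 : 1 ≤ r) (hr2 : r ≤ n) :
    (Finset.univ.filter fun i => r ≤ rk pref i (x i)).card ≤ n - r + 1 := by
  set A := Finset.univ.filter fun i => r ≤ rk pref i (x i) with hAdef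
  rcases A.eq_empty_or_nonempty with hA | hA
  · simp [hA]
  obtain ⟨a, haA, ha⟩ := hx.exists_forall_not_prefers hA
  have hr : r ≤ rk pref a (x a) := by simpa [hAdef] using haA
  have hsub : (Finset.univ.filter fun h => pref a h ≤ pref a (x a)) ⊆ insert (x a) Aᶜ := by
    intro h hh
    rw [Finset.mem_filter] at hh
    rw [Finset.mem_insert, Finset.mem_compl]
    rcases hh.2.eq_or_lt with heq | hlt
    · exact Or.inl ((pref a).injective heq)
    · exact Or.inr fun hhA => ha h hhA hlt
  have hrk : rk pref a (x a) ≤ Aᶜ.card + 1 :=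
    (Finset.card_le_card hsub).trans (Finset.card_insert_le _ _)
  have hcard : A.card + Aᶜ.card = n := by simp
  omega
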